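/- On the vector space k{T}, the commutator of the pruning and growth operators satisfies [𝔓,𝔑] = 𝔇; that is, for every rooted tree t, 𝔓(𝔑(t)) − 𝔑(𝔓(t)) = |t|·t. -/

import Mathlib

attribute [local instance] Classical.propDecidable

inductive PlanarTree : Type where
  | node : List PlanarTree → PlanarTree

namespace PlanarTree

/-- Isomorphism of (planar representatives of) rooted trees: the lists of
principal branches match up, pairwise isomorphically, after a permutation. -/
inductive Iso : PlanarTree → PlanarTree → Prop where
  | node {l m l' : List PlanarTree} :
      List.Perm l m → List.Forall₂ Iso m l' → Iso (node l) (node l')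

/-- Number of vertices. -/
def size : PlanarTree → ℕ
  | node l => 1 + (l.attach.map fun c => size c.1).sum
decreasing_by simp only [PlanarTree.node.sizeOf_spec]; exact Nat.lt_of_lt_of_le (List.sizeOf_lt_of_mem c.2) (Nat.le_add_left _ _)

mutual
  /-- All trees obtained by attaching the root of `s` by a new edge to some vertex. -/
  def graftList (s : PlanarTree) : PlanarTree → List PlanarTree
    | node l => node (s :: l) :: (graftAux s l).map node
  def graftAux (s : PlanarTree) : List PlanarTree → List (List PlanarTree)
    | [] => []
    | a :: l => ((graftList s a).map (· :: l)) ++ (graftAux s l).map (a :: ·)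
end

/-- All trees obtained by adding a new edge and terminal vertex at some vertex. -/
def growList (t : PlanarTree) : List PlanarTree := graftList (node []) t

mutual
  /-- All trees obtained by deleting one (non-root) terminal vertex. -/
  def pruneList : PlanarTree → List PlanarTree
    | node l => (pruneAux l).map node
  def pruneAux : List PlanarTree → List (List PlanarTree)
    | [] => []
    | a :: l =>
        (match a with | node [] => [l] | _ => []) ++
        ((pruneList a).map (· :: l)) ++ (pruneAux l).map (a :: ·)
end

mutual
  /-- All pairs (cut-off subtree, remaining tree) obtained by cutting one edge. -/
  def cutPairs : PlanarTree → List (PlanarTree × PlanarTree)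
    | node l => (cutAux l).map fun x => (x.1, node x.2)
  def cutAux : List PlanarTree → List (PlanarTree × List PlanarTree)
    | [] => []
    | a :: l =>
        (a, l) :: (((cutPairs a).map fun x => (x.1, x.2 :: l)) ++
          (cutAux l).map fun x => (x.1, a :: x.2))
end

/-- The order of the symmetry group `SG(t)`: the product over all vertices `v`
of the number of permutations of the branches at `v` exchanging isomorphic branches. -/
noncomputable def sg : PlanarTree → ℕ
  | node l =>
      (l.attach.map fun c => sg c.1).prod *
        Nat.card {σ : Equiv.Perm (Fin l.length) // ∀ i, Iso (l.get (σ i)) (l.get i)}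
decreasing_by simp only [PlanarTree.node.sizeOf_spec]; exact Nat.lt_of_lt_of_le (List.sizeOf_lt_of_mem c.2) (Nat.le_add_left _ _)

/-- Vertices of a planar tree, encoded as paths of child-indices from the root. -/
inductive IsVertex : PlanarTree → List ℕ → Prop where
  | root (t : PlanarTree) : IsVertex t []
  | child {l : List PlanarTree} {i : ℕ} {c : PlanarTree} {p : List ℕ} :
      l[i]? = some c → IsVertex c p → IsVertex (node l) (i :: p)

def Vertex (t : PlanarTree) : Type := {p : List ℕ // IsVertex t p}

/-- `v` lies strictly below `w` in the tree order (i.e. `w` is a proper ancestor of `v`). -/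
def StrictBelow {t : PlanarTree} (v w : Vertex t) : Prop := w.1 <+: v.1 ∧ w.1 ≠ v.1

/-- A labelling of `t`. -/
def Labelling (t : PlanarTree) : Type :=
  {f : Vertex t ≃ Fin t.size // ∀ v w, StrictBelow v w → f w < f v}

/-- Equivalence of labellings: they differ by an automorphism of the rooted tree. -/
def labelEquiv {t : PlanarTree} (f g : Labelling t) : Prop :=
  ∃ φ : Equiv.Perm (Vertex t),
    (∀ v w, StrictBelow (φ v) (φ w) ↔ StrictBelow v w) ∧ ∀ v, f.1 (φ v) = g.1 v

end PlanarTree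

/-- Rooted trees: isomorphism classes of planar rooted trees. -/
instance planarSetoid : Setoid PlanarTree := Relation.EqvGen.setoid PlanarTree.Iso

def RTree : Type := Quotient planarSetoid

namespace RTree

def mk (p : PlanarTree) : RTree := ⟦p⟧

/-- A chosen planar representative. -/
noncomputable def rep (T : RTree) : PlanarTree := Quotient.out T

noncomputable def size (T : RTree) : ℕ := T.rep.size

/-- The order of the symmetry (automorphism) group of `T`. -/
noncomputable def sg (T : RTree) : ℕ := T.rep.sg

/-- The one-vertex tree. -/
def bullet : RTree := mk (PlanarTree.node [])

/-- `Covers T T'` means `T ⊲ T'`: `T` is obtained from `T'` by deleting one terminal vertex. -/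
noncomputable def Covers (T T' : RTree) : Prop :=
  ∃ p ∈ T'.rep.pruneList, mk p = T

/-- `n(T;T')`: the number of vertices of `T` to which a new edge can be added to obtain `T'`. -/
noncomputable def nCov (T T' : RTree) : ℕ :=
  T.rep.growList.countP fun p => decide (mk p = T')

/-- `m(T;T')`: the number of (terminal) edges of `T'` which when removed leave `T`. -/
noncomputable def mCov (T T' : RTree) : ℕ :=
  T'.rep.pruneList.countP fun p => decide (mk p = T)

/-- `n(T₁,T₂;T₃)`: the number of vertices of `T₂` such that attaching the root of `T₁`
there by a new edge yields `T₃`. -/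
noncomputable def nTri (T₁ T₂ T₃ : RTree) : ℕ :=
  (PlanarTree.graftList T₁.rep T₂.rep).countP fun p => decide (mk p = T₃)

/-- `m(T₁,T₂;T₃)`: the number of edges of `T₃` whose removal cuts off a subtree
isomorphic to `T₁` leaving `T₂` (the piece containing the root). -/
noncomputable def mTri (T₁ T₂ T₃ : RTree) : ℕ :=
  T₃.rep.cutPairs.countP fun x => decide (mk x.1 = T₁ ∧ mk x.2 = T₂)

end RTree

section Ops

variable (k : Type*) [Semiring k]

/-- The element `𝔑(T) = Σ_{T ⊲ T'} n(T;T')·T'` of `k{T}`. -/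
noncomputable def growF (T : RTree) : RTree →₀ k :=
  (T.rep.growList.map fun p => Finsupp.single (RTree.mk p) (1 : k)).sum

/-- The element `𝔓(T) = Σ_{T' ⊲ T} m(T';T)·T'` of `k{T}`. -/
noncomputable def pruneF (T : RTree) : RTree →₀ k :=
  (T.rep.pruneList.map fun p => Finsupp.single (RTree.mk p) (1 : k)).sum

/-- The growth operator `𝔑` on `k{T}`. -/
noncomputable def Grow : Module.End k (RTree →₀ k) :=
  Finsupp.linearCombination k (growF k)

/-- The pruning operator `𝔓` on `k{T}`. -/
noncomputable def Prune : Module.End k (RTree →₀ k) :=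
  Finsupp.linearCombination k (pruneF k)

/-- The operator `𝔇` on `k{T}`, `𝔇(t) = |t|·t`. -/
noncomputable def Diag : Module.End k (RTree →₀ k) :=
  Finsupp.linearCombination k fun T => (T.size : k) • Finsupp.single T 1

/-- The inner product on `k{T}` determined by `(t,t') = |SG(t)|·δ_{t,t'}`. -/
noncomputable def innerT (x y : RTree →₀ k) : k :=
  x.sum fun T c => c * y T * (T.sg : k)

/-- Generalized multiplicity `n(T;T')`: coefficient of `T'` in `𝔑^{|T'|-|T|}(T)`. -/
noncomputable def nGen (T T' : RTree) : k :=
  ((Grow k ^ (T'.size - T.size)) (Finsupp.single T 1)) T'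

/-- Generalized multiplicity `m(T;T')`: coefficient of `T` in `𝔓^{|T'|-|T|}(T')`. -/
noncomputable def mGen (T T' : RTree) : k :=
  ((Prune k ^ (T'.size - T.size)) (Finsupp.single T' 1)) T

end Ops

section Kreimer

variable (k : Type*) [CommSemiring k]

/-- Kreimer's Hopf algebra `H_K`, as a commutative algebra: the free polynomial
algebra on rooted trees. -/
abbrev HK := MvPolynomial RTree k

/-- The inclusion `k{T} → H_K` of the linear span of the variables. -/
noncomputable def toHK : (RTree →₀ k) →ₗ[k] HK k :=
  Finsupp.linearCombination k fun T => MvPolynomial.X T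

/-- The growth derivation `N` on `H_K`, with `N(t) = 𝔑(t)` for rooted trees `t`. -/
noncomputable def ND : Derivation k (HK k) (HK k) :=
  MvPolynomial.mkDerivation k fun T => toHK k (growF k T)

/-- The pruning derivation `P` on `H_K`, with `P(t) = 𝔓(t)` for `|t| ≥ 2`, `P(•) = 1`. -/
noncomputable def PD : Derivation k (HK k) (HK k) :=
  MvPolynomial.mkDerivation k fun T =>
    if T = RTree.bullet then 1 else toHK k (pruneF k T)

/-- The grading derivation `D` on `H_K`, multiplying each homogeneous element of
degree `n` by `n`; it is the derivation with `D(t) = |t|·t` for rooted trees `t`. -/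
noncomputable def DD : Derivation k (HK k) (HK k) :=
  MvPolynomial.mkDerivation k fun T => (T.size : k) • MvPolynomial.X T

/-- The map `B₊ : H_K → k{T}` sending a forest to the tree obtained by attaching
all its roots to a new root vertex. -/
noncomputable def forestTree (d : RTree →₀ ℕ) : RTree :=
  RTree.mk (PlanarTree.node
    (d.support.toList.flatMap fun T => List.replicate (d T) T.rep))

noncomputable def Bplus (p : HK k) : RTree →₀ k :=
  ∑ d ∈ p.support, Finsupp.single (forestTree d) (MvPolynomial.coeff d p)

/-- The inner product on `H_K`. -/
noncomputable def innerHK (u v : HK k) : k := innerT k (Bplus k u) (Bplus k v)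

/-- The degree-`n` homogeneous component of `H_K`. -/
noncomputable abbrev HKcomp (n : ℕ) : Submodule k (HK k) :=
  MvPolynomial.weightedHomogeneousSubmodule k (fun T : RTree => T.size) n

/-- `T_i`: the number of rooted trees with `i+1` vertices. -/
noncomputable def Tcard (i : ℕ) : ℕ := Nat.card {T : RTree // T.size = i + 1}

end Kreimer

namespace PlanarTree

section Sums

variable {M : Type*} [AddCommMonoid M]

theorem size_node (l : List PlanarTree) : size (node l) = 1 + (l.map size).sum := by
  simp [size]

/-- The contribution to `pruneAux (a :: l)` of deleting `a` itself. -/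
def pruneHead (g : List PlanarTree → M) : PlanarTree → List PlanarTree → M
  | node [], l => g l
  | node (_ :: _), _ => 0

theorem sum_graftList_node (s : PlanarTree) (l : List PlanarTree) (f : PlanarTree → M) :
    ((graftList s (node l)).map f).sum =
      f (node (s :: l)) + ((graftAux s l).map fun m => f (node m)).sum := by
  simp [graftList, Function.comp_def]

theorem sum_graftAux_cons (s a : PlanarTree) (l : List PlanarTree) (g : List PlanarTree → M) :
    ((graftAux s (a :: l)).map g).sum =
      ((graftList s a).map fun b => g (b :: l)).sum +
        ((graftAux s l).map fun m => g (a :: m)).sum := by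
  simp [graftAux, Function.comp_def]

theorem sum_pruneList_node (l : List PlanarTree) (f : PlanarTree → M) :
    ((pruneList (node l)).map f).sum = ((pruneAux l).map fun m => f (node m)).sum := by
  simp [pruneList, Function.comp_def]

theorem sum_pruneAux_cons (a : PlanarTree) (l : List PlanarTree) (g : List PlanarTree → M) :
    ((pruneAux (a :: l)).map g).sum =
      pruneHead g a l + ((pruneList a).map fun b => g (b :: l)).sum +
        ((pruneAux l).map fun m => g (a :: m)).sum := by
  rcases a with ⟨_ | ⟨b, c⟩⟩ <;> simp [pruneAux, pruneHead, Function.comp_def, add_assoc]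

theorem sum_map_sum_comm {α β : Type*} (l : List α) (m : List β) (f : α → β → M) :
    (l.map fun a => (m.map fun b => f a b).sum).sum =
      (m.map fun b => (l.map fun a => f a b).sum).sum := by
  simpa using Multiset.sum_map_sum_map (l : Multiset α) (m : Multiset β) (f := f)

theorem sum_graftList_pruneHead (s a : PlanarTree) (l : List PlanarTree)
    (g : List PlanarTree → M) :
    ((graftList s a).map fun b => pruneHead g b l).sum = 0 := by
  apply List.sum_eq_zero
  rcases a with ⟨a⟩
  cases a <;> simp +contextual [graftList, graftAux, pruneHead, or_imp]

theorem sum_graftAux_pruneHead (s a : PlanarTree) (l : List PlanarTree)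
    (g : List PlanarTree → M) :
    ((graftAux s l).map fun m => pruneHead g a m).sum =
      pruneHead (fun m => ((graftAux s m).map g).sum) a l := by
  rcases a with ⟨_ | ⟨b, c⟩⟩ <;> simp [pruneHead]

mutual

theorem sum_growList_pruneList (f : PlanarTree → M) : ∀ t : PlanarTree,
    ((growList t).map fun q => ((pruneList q).map f).sum).sum =
      ((pruneList t).map fun q => ((growList q).map f).sum).sum + size t • f t
  | node l => by
    simp only [growList, sum_graftList_node, sum_pruneList_node, sum_pruneAux_cons, pruneHead,
      List.sum_map_add, size_node, sum_graftAux_pruneAux (fun m => f (node m)) l]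
    simp [pruneAux, add_smul]
    abel

theorem sum_graftAux_pruneAux (g : List PlanarTree → M) : ∀ l : List PlanarTree,
    ((graftAux (node []) l).map fun m => ((pruneAux m).map g).sum).sum =
      ((pruneAux l).map fun m => ((graftAux (node []) m).map g).sum).sum +
        (l.map size).sum • g l
  | [] => by simp [graftAux, pruneAux]
  | a :: l => by
    have ha := sum_growList_pruneList (fun b => g (b :: l)) a
    have hl := sum_graftAux_pruneAux (fun m => g (a :: m)) l
    simp only [growList] at ha
    simp only [sum_graftAux_cons, sum_pruneAux_cons, List.sum_map_add, ha, hl,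
      sum_graftList_pruneHead, sum_graftAux_pruneHead, List.map_cons, List.sum_cons, add_smul]
    rw [sum_map_sum_comm (graftList (node []) a) (pruneAux l),
      sum_map_sum_comm (graftAux (node []) l) (pruneList a)]
    abel

end

end Sums

theorem Iso.refl : ∀ t : PlanarTree, Iso t t
  | .node l => .node (List.Perm.refl l) (List.forall₂_same.2 fun t _ => Iso.refl t)
decreasing_by
  simp only [PlanarTree.node.sizeOf_spec]
  exact Nat.lt_of_lt_of_le (List.sizeOf_lt_of_mem (by assumption)) (Nat.le_add_left _ _)

theorem forall₂_iso_refl (l : List PlanarTree) : List.Forall₂ Iso l l :=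
  List.forall₂_same.2 fun t _ => Iso.refl t

section Invariance

variable {M : Type*} [AddCommMonoid M]

theorem pruneHead_congr {g : List PlanarTree → M} {a : PlanarTree} {l m : List PlanarTree}
    (h : g l = g m) : pruneHead g a l = pruneHead g a m := by
  rcases a with ⟨_ | ⟨b, c⟩⟩ <;> simp [pruneHead, h]

theorem pruneHead_cons (g : List PlanarTree → M) (a b : PlanarTree) (l : List PlanarTree) :
    pruneHead (fun m => g (b :: m)) a l = pruneHead g a (b :: l) := by
  rcases a with ⟨_ | ⟨c, d⟩⟩ <;> rfl

theorem pruneHead_iso (g : List PlanarTree → M) {a b : PlanarTree} (h : Iso a b)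
    (l : List PlanarTree) : pruneHead g a l = pruneHead g b l := by
  obtain ⟨h₁, h₂⟩ := h
  rename_i l₁ l₂ l₃
  have := h₁.length_eq.trans h₂.length_eq
  cases l₁ <;> cases l₃ <;> simp_all [pruneHead]

theorem sum_graftAux_perm (s : PlanarTree) {l m : List PlanarTree} (h : l.Perm m)
    (g : List PlanarTree → M) (hg : ∀ l m, l.Perm m → g l = g m) :
    ((graftAux s l).map g).sum = ((graftAux s m).map g).sum := by
  induction h generalizing g with
  | nil => rfl
  | cons a h ih =>
    rw [sum_graftAux_cons, sum_graftAux_cons, ih _ fun l m h => hg _ _ (h.cons a)]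
    simp only [fun b => hg _ _ (h.cons b)]
  | swap a b l =>
    simp only [sum_graftAux_cons, fun x y l => hg _ _ (List.Perm.swap x y l)]
    rw [add_left_comm]
  | trans _ _ ih₁ ih₂ => exact (ih₁ g hg).trans (ih₂ g hg)

theorem sum_pruneAux_perm {l m : List PlanarTree} (h : l.Perm m)
    (g : List PlanarTree → M) (hg : ∀ l m, l.Perm m → g l = g m) :
    ((pruneAux l).map g).sum = ((pruneAux m).map g).sum := by
  induction h generalizing g with
  | nil => rfl
  | cons a h ih =>
    rw [sum_pruneAux_cons, sum_pruneAux_cons, ih _ fun l m h => hg _ _ (h.cons a),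
      pruneHead_congr (hg _ _ h)]
    simp only [fun b => hg _ _ (h.cons b)]
  | swap a b l =>
    simp only [sum_pruneAux_cons, pruneHead_cons, fun x y l => hg _ _ (List.Perm.swap x y l)]
    abel
  | trans _ _ ih₁ ih₂ => exact (ih₁ g hg).trans (ih₂ g hg)

mutual

theorem sum_graftList_iso (s : PlanarTree) (f : PlanarTree → M)
    (hf : ∀ a b, Iso a b → f a = f b) : ∀ a b : PlanarTree, Iso a b →
    ((graftList s a).map f).sum = ((graftList s b).map f).sum
  | a, node l, h => by
    cases h with
    | node h₁ h₂ =>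
      rw [sum_graftList_node, sum_graftList_node,
        sum_graftAux_perm s h₁ _ fun l m h => hf _ _ (.node h (forall₂_iso_refl m)),
        sum_graftAux_forall₂ s (fun m => f (node m)) (fun l m h => hf _ _ (.node (.refl l) h))
          l _ h₂,
        hf _ _ (.node (h₁.cons s) (.cons (.refl s) h₂))]

theorem sum_graftAux_forall₂ (s : PlanarTree) (g : List PlanarTree → M)
    (hg : ∀ l m, List.Forall₂ Iso l m → g l = g m) : ∀ m l : List PlanarTree,
    List.Forall₂ Iso l m → ((graftAux s l).map g).sum = ((graftAux s m).map g).sum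
  | [], l, h => by cases h; rfl
  | b :: m, l, h => by
    cases h with
    | cons h₁ h₂ =>
      rw [sum_graftAux_cons, sum_graftAux_cons,
        sum_graftList_iso s _ (fun a b h => hg _ _ (.cons h (forall₂_iso_refl _))) _ b h₁,
        sum_graftAux_forall₂ s _ (fun l m h => hg _ _ (.cons (.refl _) h)) m _ h₂]
      simp only [fun b => hg _ _ (.cons (.refl b) h₂),
        fun m => hg _ _ (.cons h₁ (forall₂_iso_refl m))]

end

mutual

theorem sum_pruneList_iso (f : PlanarTree → M)
    (hf : ∀ a b, Iso a b → f a = f b) : ∀ a b : PlanarTree, Iso a b →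
    ((pruneList a).map f).sum = ((pruneList b).map f).sum
  | a, node l, h => by
    cases h with
    | node h₁ h₂ =>
      rw [sum_pruneList_node, sum_pruneList_node,
        sum_pruneAux_perm h₁ _ fun l m h => hf _ _ (.node h (forall₂_iso_refl m)),
        sum_pruneAux_forall₂ (fun m => f (node m)) (fun l m h => hf _ _ (.node (.refl l) h))
          l _ h₂]

theorem sum_pruneAux_forall₂ (g : List PlanarTree → M)
    (hg : ∀ l m, List.Forall₂ Iso l m → g l = g m) : ∀ m l : List PlanarTree,
    List.Forall₂ Iso l m → ((pruneAux l).map g).sum = ((pruneAux m).map g).sum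
  | [], l, h => by cases h; rfl
  | b :: m, l, h => by
    cases h with
    | cons h₁ h₂ =>
      rw [sum_pruneAux_cons, sum_pruneAux_cons, pruneHead_congr (hg _ _ h₂), pruneHead_iso g h₁,
        sum_pruneList_iso _ (fun a b h => hg _ _ (.cons h (forall₂_iso_refl _))) _ b h₁,
        sum_pruneAux_forall₂ _ (fun l m h => hg _ _ (.cons (.refl _) h)) m _ h₂]
      simp only [fun b => hg _ _ (.cons (.refl b) h₂),
        fun m => hg _ _ (.cons h₁ (forall₂_iso_refl m))]

end

end Invariance

end PlanarTree

namespace RTree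

theorem mk_rep (T : RTree) : mk T.rep = T := Quotient.out_eq T

theorem mk_eq_mk_of_iso {a b : PlanarTree} (h : a.Iso b) : mk a = mk b :=
  Quotient.sound (.rel a b h)

theorem eq_of_mk_eq_mk {α : Type*} {F : PlanarTree → α} (hF : ∀ a b, a.Iso b → F a = F b)
    {a b : PlanarTree} (h : mk a = mk b) : F a = F b := by
  have h' : Relation.EqvGen PlanarTree.Iso a b := Quotient.exact h
  clear h
  induction h' with
  | rel a b h => exact hF a b h
  | refl => rfl
  | symm _ _ _ ih => exact ih.symm
  | trans _ _ _ _ _ ih₁ ih₂ => exact ih₁.trans ih₂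

end RTree

theorem growF_mk (k : Type*) [Semiring k] (p : PlanarTree) :
    growF k (RTree.mk p) = (p.growList.map fun q => Finsupp.single (RTree.mk q) (1 : k)).sum :=
  RTree.eq_of_mk_eq_mk
    (F := fun p => (p.growList.map fun q => Finsupp.single (RTree.mk q) (1 : k)).sum)
    (fun a b h => PlanarTree.sum_graftList_iso _ _
      (fun _ _ h => by rw [RTree.mk_eq_mk_of_iso h]) a b h) (RTree.mk_rep _)

theorem pruneF_mk (k : Type*) [Semiring k] (p : PlanarTree) :
    pruneF k (RTree.mk p) = (p.pruneList.map fun q => Finsupp.single (RTree.mk q) (1 : k)).sum :=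
  RTree.eq_of_mk_eq_mk
    (F := fun p => (p.pruneList.map fun q => Finsupp.single (RTree.mk q) (1 : k)).sum)
    (fun a b h => PlanarTree.sum_pruneList_iso _
      (fun _ _ h => by rw [RTree.mk_eq_mk_of_iso h]) a b h) (RTree.mk_rep _)

/-- On `k{T}`, `[𝔓,𝔑] = 𝔇`; i.e. `𝔓𝔑 - 𝔑𝔓` is the operator
`t ↦ |t|·t`. -/
theorem stmt1 (k : Type*) [Field k] [CharZero k] :
    Prune k * Grow k - Grow k * Prune k = Diag k := by
  refine Finsupp.lhom_ext' fun T => LinearMap.ext_ring ?_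
  have h := PlanarTree.sum_growList_pruneList
    (fun q => Finsupp.single (RTree.mk q) (1 : k)) T.rep
  simp only [RTree.mk_rep] at h
  have hG : Grow k (pruneF k T) = (T.rep.pruneList.map fun q => growF k (RTree.mk q)).sum := by
    simp [Grow, pruneF, map_list_sum, Function.comp_def]
  have hP : Prune k (growF k T) = (T.rep.growList.map fun q => pruneF k (RTree.mk q)).sum := by
    simp [Prune, growF, map_list_sum, Function.comp_def]
  simp only [growF_mk, pruneF_mk] at hG hP
  have hG₁ : Grow k (Finsupp.single T 1) = growF k T := by simp [Grow]
  have hP₁ : Prune k (Finsupp.single T 1) = pruneF k T := by simp [Prune]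
  simp only [LinearMap.comp_apply, LinearMap.sub_apply, Module.End.mul_apply,
    Finsupp.lsingle_apply, hG₁, hP₁, hG, hP, h]
  simp [Diag, RTree.size]
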